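/- Assume the compound Poisson setup and let γ = 0. Then either T(0) = (0,∞) or T(0) = ∅ (the case T(0) = a₀ℕ with a₀ > 0 cannot occur). Moreover, T(0) = (0,∞) holds if and only if lim_{x→∞} ν₁((x, x+1]) / tail(ν₁^{n₀*})(x) = 0. -/

import Mathlib

open MeasureTheory Filter Set

/-- The tail `ξ((x,∞))` of a measure on `ℝ`, as a real number. -/
noncomputable def tail (ξ : MeasureTheory.Measure ℝ) (x : ℝ) : ℝ :=
  (ξ (Set.Ioi x)).toReal

/-- The `n`-fold convolution power of a measure, with `ξ^{0*} = δ₀`. -/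
noncomputable def convPow (ρ : MeasureTheory.Measure ℝ) : ℕ → MeasureTheory.Measure ℝ
  | 0 => MeasureTheory.Measure.dirac 0
  | n + 1 => (convPow ρ n).conv ρ

/-- `ξ ≍ ζ` for tails: `0 < liminf tail ξ/tail ζ ≤ limsup tail ξ/tail ζ < ∞`
(taken in `ℝ≥0∞`). -/
def TailAsymp (ξ ζ : MeasureTheory.Measure ℝ) : Prop :=
  0 < Filter.atTop.liminf (fun x : ℝ => ξ (Set.Ioi x) / ζ (Set.Ioi x)) ∧
    Filter.atTop.limsup (fun x : ℝ => ξ (Set.Ioi x) / ζ (Set.Ioi x)) < ⊤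

/-- The class `OS` of O-subexponential distributions. -/
def MemOS (ρ : MeasureTheory.Measure ℝ) : Prop :=
  (∀ x : ℝ, 0 < x → 0 < ρ (Set.Ioi x)) ∧ TailAsymp (convPow ρ 2) ρ

/-- The class `L(γ)`: `tail ρ(x+a) ~ e^{-γ a} tail ρ(x)` for every `a`. -/
def MemL (γ : ℝ) (ρ : MeasureTheory.Measure ℝ) : Prop :=
  (∀ x : ℝ, 0 < x → 0 < ρ (Set.Ioi x)) ∧
    ∀ a : ℝ, Filter.Tendsto
      (fun x : ℝ => tail ρ (x + a) / (Real.exp (-γ * a) * tail ρ x))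
      Filter.atTop (nhds 1)

/-- The class `S(γ)`. -/
def MemS (γ : ℝ) (ρ : MeasureTheory.Measure ℝ) : Prop :=
  MemL γ ρ ∧ MeasureTheory.Integrable (fun x : ℝ => Real.exp (γ * x)) ρ ∧
    Filter.Tendsto
      (fun x : ℝ => tail (ρ.conv ρ) x /
        (2 * (∫ y : ℝ, Real.exp (γ * y) ∂ρ) * tail ρ x))
      Filter.atTop (nhds 1)

/-- The class `S_♯`. -/
def MemSsharp (ρ : MeasureTheory.Measure ℝ) : Prop :=
  MemOS ρ ∧
    Filter.atTop.limsup (fun A : ℝ => Filter.atTop.limsup (fun x : ℝ =>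
      (tail ρ (x - A) * tail ρ A + ∫ u in Set.Ioc A (x - A), tail ρ (x - u) ∂ρ)
        / tail ρ x)) = 0

/-- The compound Poisson distribution `μ_t = e^{-t} ∑_k (t^k/k!) ν₁^{k*}`. -/
noncomputable def cpois (nu1 : MeasureTheory.Measure ℝ) (t : ℝ) : MeasureTheory.Measure ℝ :=
  MeasureTheory.Measure.sum (fun k : ℕ =>
    (ENNReal.ofReal (Real.exp (-t) * t ^ k / (Nat.factorial k))) • convPow nu1 k)

/-- `T(γ) = {t > 0 : μ_t ∈ L(γ)}`. -/
def Tset (nu1 : MeasureTheory.Measure ℝ) (γ : ℝ) : Set ℝ :=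
  {t : ℝ | 0 < t ∧ MemL γ (cpois nu1 t)}

/-- `f` is negligible with respect to `H` at infinity. -/
def Negl (H f : ℝ → ENNReal) : Prop :=
  ∀ ε : ENNReal, ε ≠ 0 → ∀ᶠ x in atTop, f x ≤ ε * H x

lemma Negl.add {H f g : ℝ → ENNReal} (hf : Negl H f) (hg : Negl H g) :
    Negl H (fun x => f x + g x) := by
  intro ε hε
  have h2 : ε / 2 ≠ 0 := (ENNReal.half_pos hε).ne'
  filter_upwards [hf _ h2, hg _ h2] with x h1 h2
  calc f x + g x ≤ ε / 2 * H x + ε / 2 * H x := add_le_add h1 h2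
    _ = ε * H x := by rw [← add_mul, ENNReal.add_halves]

lemma Negl.mono {H f g : ℝ → ENNReal} (hf : Negl H f) (hg : ∀ᶠ x in atTop, g x ≤ f x) :
    Negl H g := by
  intro ε hε
  filter_upwards [hf _ hε, hg] with x h1 h2 using h2.trans h1

lemma Negl.const_mul {H f : ℝ → ENNReal} (hf : Negl H f) {c : ENNReal} (hc : c ≠ ⊤) :
    Negl H (fun x => c * f x) := by
  intro ε hε
  have hd : ε / (c + 1) ≠ 0 := ENNReal.div_ne_zero.2 ⟨hε, by simp [hc]⟩
  filter_upwards [hf _ hd] with x hx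
  calc c * f x ≤ (c + 1) * (ε / (c + 1) * H x) := by gcongr; exact le_self_add
    _ = ε * H x := by
      rw [← mul_assoc, ENNReal.mul_div_cancel (by simp) (by simp [hc])]

lemma Negl.sum {H : ℝ → ENNReal} {f : ℕ → ℝ → ENNReal} (hf : ∀ k, Negl H (f k)) (N : ℕ) :
    Negl H (fun x => ∑ k ∈ Finset.range N, f k x) := by
  induction N with
  | zero => intro ε _; simp
  | succ N ih => simp only [Finset.sum_range_succ]; exact ih.add (hf N)

/-- Replacing the comparison function by a dominating one. -/
lemma Negl.of_dom {H G f : ℝ → ENNReal} (hf : Negl H f) {c : ENNReal} (hc : c ≠ ⊤)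
    (h : ∀ᶠ x in atTop, H x ≤ c * G x) : Negl G f := by
  intro ε hε
  have hd : ε / (c + 1) ≠ 0 := ENNReal.div_ne_zero.2 ⟨hε, by simp [hc]⟩
  filter_upwards [hf _ hd, h] with x hx hx2
  calc f x ≤ ε / (c + 1) * H x := hx
    _ ≤ ε / (c + 1) * ((c + 1) * G x) := by
        gcongr; exact hx2.trans (by gcongr; exact le_self_add)
    _ = ε * G x := by
      rw [← mul_assoc, ENNReal.div_mul_cancel (by simp) (by simp [hc])]

lemma Negl.shift {H f : ℝ → ENNReal} (hf : Negl H f) {c : ENNReal} (hc : c ≠ ⊤)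
    (h : ∀ᶠ x in atTop, H (x - 1) ≤ c * H x) : Negl H (fun x => f (x - 1)) := by
  have : Negl (fun x => H (x - 1)) (fun x => f (x - 1)) := by
    intro ε hε
    have ht : Tendsto (fun x : ℝ => x - 1) atTop atTop := tendsto_atTop_add_const_right _ _ tendsto_id
    exact ht.eventually (hf ε hε)
  exact this.of_dom hc h

/-- Convergence to `0` of the ratio versus negligibility. -/
lemma negl_iff_tendsto {H f : ℝ → ENNReal} (hH0 : ∀ᶠ x in atTop, H x ≠ 0)
    (hH : ∀ x, H x ≠ ⊤) (hf : ∀ x, f x ≠ ⊤) :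
    Negl H f ↔ Tendsto (fun x => (f x).toReal / (H x).toReal) atTop (nhds 0) := by
  have key : Negl H f ↔ Tendsto (fun x => f x / H x) atTop (nhds 0) := by
    rw [ENNReal.tendsto_nhds_zero]
    constructor
    · intro h ε hε
      filter_upwards [h ε hε.ne', hH0] with x hx h0
      exact (ENNReal.div_le_iff h0 (hH x)).2 hx
    · intro h ε hε
      filter_upwards [h ε (pos_iff_ne_zero.2 hε), hH0] with x hx h0
      exact (ENNReal.div_le_iff h0 (hH x)).1 hx
  rw [key]
  have h1 : Tendsto (fun x => f x / H x) atTop (nhds 0) ↔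
      Tendsto (fun x => ENNReal.ofReal ((f x).toReal / (H x).toReal)) atTop (nhds 0) := by
    apply tendsto_congr'
    filter_upwards [hH0] with x h0
    rw [← ENNReal.toReal_div, ENNReal.ofReal_toReal (ENNReal.div_ne_top (hf x) h0)]
  rw [h1]
  constructor
  · intro h
    have := (ENNReal.tendsto_toReal ENNReal.zero_ne_top).comp h
    simp only [ENNReal.toReal_zero] at this
    refine this.congr fun x => ?_
    simp only [Function.comp]
    exact ENNReal.toReal_ofReal (by positivity)
  · intro h
    simpa using ENNReal.tendsto_ofReal h

instance convPow_prob (ρ : Measure ℝ) [IsProbabilityMeasure ρ] (n : ℕ) :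
    IsProbabilityMeasure (convPow ρ n) := by
  induction n with
  | zero => unfold convPow; infer_instance
  | succ n ih => unfold convPow; infer_instance

lemma convPow_add (ρ : Measure ℝ) [IsProbabilityMeasure ρ] (k m : ℕ) :
    convPow ρ (k + m) = (convPow ρ k).conv (convPow ρ m) := by
  induction m with
  | zero => simp [convPow]
  | succ m ih =>
    change (convPow ρ (k + m)).conv ρ = (convPow ρ k).conv ((convPow ρ m).conv ρ)
    rw [ih, Measure.conv_assoc]

lemma conv_apply_set (μ ν : Measure ℝ) [SFinite ν] {s : Set ℝ} (hs : MeasurableSet s) :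
    (μ.conv ν) s = ∫⁻ u, ν ((fun y => u + y) ⁻¹' s) ∂μ := by
  rw [← lintegral_indicator_one hs, Measure.lintegral_conv (measurable_one.indicator hs)]
  refine lintegral_congr fun u => ?_
  rw [← lintegral_indicator_one (hs.preimage (measurable_const_add u))]
  rfl

lemma conv_Ioi (μ ν : Measure ℝ) [SFinite ν] (x : ℝ) :
    (μ.conv ν) (Ioi x) = ∫⁻ u, ν (Ioi (x - u)) ∂μ := by
  rw [conv_apply_set _ _ measurableSet_Ioi]
  simp

lemma conv_Ioc (μ ν : Measure ℝ) [SFinite ν] (x : ℝ) :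
    (μ.conv ν) (Ioc x (x + 1)) = ∫⁻ u, ν (Ioc (x - u) (x - u + 1)) ∂μ := by
  rw [conv_apply_set _ _ measurableSet_Ioc]
  refine lintegral_congr fun u => ?_
  simp only [preimage_const_add_Ioc]
  congr 2
  ring

/-- Poisson weights. -/
noncomputable def pw (t : ℝ) (k : ℕ) : ENNReal :=
  ENNReal.ofReal (Real.exp (-t) * t ^ k / (Nat.factorial k))

lemma pw_ne_zero {t : ℝ} (ht : 0 < t) (k : ℕ) : pw t k ≠ 0 := by
  unfold pw
  have : 0 < Real.exp (-t) * t ^ k / (Nat.factorial k) := by positivity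
  simpa using this

lemma cpois_apply (ρ : Measure ℝ) (t : ℝ) {s : Set ℝ} (hs : MeasurableSet s) :
    cpois ρ t s = ∑' k, pw t k * convPow ρ k s := by
  unfold cpois
  rw [Measure.sum_apply _ hs]
  rfl

lemma le_cpois (ρ : Measure ℝ) (t : ℝ) (k : ℕ) {s : Set ℝ} (hs : MeasurableSet s) :
    pw t k * convPow ρ k s ≤ cpois ρ t s := by
  rw [cpois_apply _ _ hs]
  exact ENNReal.le_tsum k

lemma cpois_ne_top (ρ : Measure ℝ) [IsProbabilityMeasure ρ] {t : ℝ} (ht : 0 < t) {s : Set ℝ}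
    (hs : MeasurableSet s) : cpois ρ t s ≠ ⊤ := by
  rw [cpois_apply _ _ hs]
  have h1 : ∑' k, pw t k * convPow ρ k s ≤ ∑' k, pw t k :=
    ENNReal.tsum_le_tsum fun k => mul_le_of_le_one_right' prob_le_one
  refine ne_top_of_le_ne_top ?_ h1
  have hs : Summable fun k : ℕ => Real.exp (-t) * t ^ k / (Nat.factorial k) := by
    simp_rw [mul_div_assoc]
    exact (Real.summable_pow_div_factorial t).mul_left _
  exact hs.tsum_ofReal_ne_top

lemma pw_two (t : ℝ) (ht : 0 < t) (k : ℕ) :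
    pw t k = ENNReal.ofReal (Real.exp t) * ENNReal.ofReal ((1/2) ^ k) * pw (2 * t) k := by
  unfold pw
  rw [← ENNReal.ofReal_mul (by positivity), ← ENNReal.ofReal_mul (by positivity)]
  congr 1
  have : Real.exp (-t) = Real.exp t * Real.exp (-(2 * t)) := by
    rw [← Real.exp_add]; congr 1; ring
  rw [this, mul_pow]
  have h2 : (1/2 : ℝ) ^ k * 2 ^ k = 1 := by rw [← mul_pow]; norm_num
  calc _ = Real.exp t * Real.exp (-(2 * t)) * t ^ k / (Nat.factorial k) * 1 := by ring
    _ = Real.exp t * Real.exp (-(2 * t)) * t ^ k / (Nat.factorial k) *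
        ((1/2 : ℝ) ^ k * 2 ^ k) := by rw [h2]
    _ = _ := by ring

lemma asymp_upper {ξ ζ : Measure ℝ} (h : TailAsymp ξ ζ) (h0 : ∀ᶠ x in atTop, ζ (Ioi x) ≠ 0)
    (ht : ∀ x, ζ (Ioi x) ≠ ⊤) :
    ∃ C : ENNReal, C ≠ ⊤ ∧ ∀ᶠ x in atTop, ξ (Ioi x) ≤ C * ζ (Ioi x) := by
  obtain ⟨C, h1, h2⟩ := exists_between h.2
  refine ⟨C, h2.ne, ?_⟩
  filter_upwards [eventually_lt_of_limsup_lt h1, h0] with x hx hx0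
  exact (ENNReal.div_le_iff hx0 (ht x)).1 hx.le

lemma asymp_lower {ξ ζ : Measure ℝ} (h : TailAsymp ξ ζ) (h0 : ∀ᶠ x in atTop, ζ (Ioi x) ≠ 0)
    (ht : ∀ x, ζ (Ioi x) ≠ ⊤) :
    ∃ C : ENNReal, C ≠ ⊤ ∧ ∀ᶠ x in atTop, ζ (Ioi x) ≤ C * ξ (Ioi x) := by
  obtain ⟨c, h1, h2⟩ := exists_between h.1
  have hct : c ≠ ⊤ := h2.ne_top
  refine ⟨c⁻¹, ENNReal.inv_ne_top.2 h1.ne', ?_⟩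
  filter_upwards [eventually_lt_of_lt_liminf h2, h0] with x hx hx0
  have h3 : c * ζ (Ioi x) ≤ ξ (Ioi x) :=
    (ENNReal.le_div_iff_mul_le (Or.inl hx0) (Or.inl (ht x))).1 hx.le
  calc ζ (Ioi x) = c⁻¹ * (c * ζ (Ioi x)) := by
        rw [← mul_assoc, ENNReal.inv_mul_cancel h1.ne' hct, one_mul]
    _ ≤ _ := by gcongr

section setup

variable {nu : Measure ℝ} [IsProbabilityMeasure nu] {H : ℝ → ENNReal}

lemma convPow_dom {C : ENNReal} (hC : C ≠ ⊤)
    (h : ∀ᶠ x in atTop, cpois nu 1 (Ioi x) ≤ C * H x) (k : ℕ) :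
    ∃ D : ENNReal, D ≠ ⊤ ∧ ∀ᶠ x in atTop, convPow nu k (Ioi x) ≤ D * H x := by
  have hp := pw_ne_zero one_pos k
  have hpt : pw 1 k ≠ ⊤ := ENNReal.ofReal_ne_top
  refine ⟨(pw 1 k)⁻¹ * C, ENNReal.mul_ne_top (ENNReal.inv_ne_top.2 hp) hC, ?_⟩
  filter_upwards [h] with x hx
  calc convPow nu k (Ioi x) = (pw 1 k)⁻¹ * (pw 1 k * convPow nu k (Ioi x)) := by
        rw [← mul_assoc, ENNReal.inv_mul_cancel hp hpt, one_mul]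
    _ ≤ (pw 1 k)⁻¹ * (C * H x) := by
        gcongr _ * ?_
        exact (le_cpois nu 1 k measurableSet_Ioi).trans hx
    _ = _ := by rw [mul_assoc]

lemma shift_le (hsupp : nu (Ioi 1) = 1) (n : ℕ) (x : ℝ) :
    convPow nu n (Ioi (x - 1)) ≤ convPow nu (n + 1) (Ioi x) := by
  change _ ≤ ((convPow nu n).conv nu) (Ioi x)
  rw [conv_Ioi, ← lintegral_indicator_one measurableSet_Ioi]
  refine lintegral_mono fun u => ?_
  by_cases hu : u ∈ Ioi (x - 1)
  · rw [indicator_of_mem hu]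
    have : x - u ≤ 1 := by have := mem_Ioi.1 hu; linarith
    calc (1 : ENNReal) = nu (Ioi 1) := hsupp.symm
      _ ≤ _ := measure_mono (Ioi_subset_Ioi this)
  · rw [indicator_of_notMem hu]; exact zero_le

lemma nu_Iic (hsupp : nu (Ioi 1) = 1) : nu (Iic 1) = 0 := by
  rw [← compl_Ioi, prob_compl_eq_zero_iff measurableSet_Ioi]; exact hsupp

lemma negl_block {ρ : Measure ℝ} {D : ENNReal} (hD : D ≠ ⊤)
    (hsh : ∀ᶠ x in atTop, H (x - 1) ≤ D * H x)
    (h : Negl H (fun x => ρ (Ioc x (x + 1)))) (A : ℕ) :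
    Negl H (fun x => ρ (Ioc (x - A) x)) := by
  induction A with
  | zero => intro ε _; simp
  | succ A ih =>
    refine ((ih.add h).shift hD hsh).mono (Eventually.of_forall fun x => ?_)
    refine (measure_mono ?_).trans (measure_union_le _ _)
    intro y hy
    simp only [mem_Ioc, mem_union, Nat.cast_succ] at hy ⊢
    rcases le_or_gt y (x - 1) with h1 | h1
    · left; constructor <;> linarith
    · right; constructor <;> linarith

lemma negl_convPow (hsupp : nu (Ioi 1) = 1) (n : ℕ)
    (hdom : ∀ k, ∃ D : ENNReal, D ≠ ⊤ ∧
      ∀ᶠ x in atTop, convPow nu k (Ioi x) ≤ D * convPow nu n (Ioi x))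
    (h : Negl (fun x => convPow nu n (Ioi x)) (fun x => nu (Ioc x (x + 1)))) (k : ℕ) :
    Negl (fun x => convPow nu n (Ioi x)) (fun x => convPow nu k (Ioc x (x + 1))) := by
  obtain ⟨D, hD, hD2⟩ := hdom (n + 1)
  have hsh : ∀ᶠ x in atTop, convPow nu n (Ioi (x - 1)) ≤ D * convPow nu n (Ioi x) := by
    filter_upwards [hD2] with x hx using (shift_le hsupp n x).trans hx
  induction k with
  | zero =>
    intro ε _
    filter_upwards [eventually_gt_atTop 0] with x hx
    have : convPow nu 0 (Ioc x (x + 1)) = 0 := by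
      simp only [convPow]
      rw [Measure.dirac_apply' _ measurableSet_Ioc]
      simp [hx.le]
    rw [this]; exact zero_le
  | succ k ih =>
    intro ε hε
    obtain ⟨E, hE, hE2⟩ := hdom (k + n)
    have hε2 : ε / 2 ≠ 0 := (ENNReal.half_pos hε).ne'
    set δ : ENNReal := ε / 2 / (E + 1) with hδ
    have hδ0 : δ ≠ 0 := ENNReal.div_ne_zero.2 ⟨hε2, by simp [hE]⟩
    obtain ⟨A0, hA0⟩ := eventually_atTop.1 (h δ hδ0)
    obtain ⟨A, hA⟩ := exists_nat_ge A0
    have hblock := negl_block (ρ := convPow nu k) (H := fun x => convPow nu n (Ioi x)) hD hsh ih A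
    filter_upwards [hblock _ hε2, hE2] with x hx1 hx2
    have hpt : ∀ u, nu (Ioc (x - u) (x - u + 1)) ≤
        δ * convPow nu n (Ioi (x - u)) + (Ioc (x - A) x).indicator 1 u := by
      intro u
      rcases le_or_gt u (x - A) with h1 | h1
      · exact (hA0 (x - u) (by linarith)).trans le_self_add
      · rcases le_or_gt u x with h2 | h2
        · rw [indicator_of_mem (show u ∈ Ioc (x - A) x from ⟨h1, h2⟩)]
          exact prob_le_one.trans le_add_self
        · have : nu (Ioc (x - u) (x - u + 1)) = 0 :=
            measure_mono_null (fun y hy => by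
              have := hy.2; simp only [mem_Iic]; linarith) (nu_Iic hsupp)
          rw [this]; exact zero_le
    change ((convPow nu k).conv nu) (Ioc x (x + 1)) ≤ _
    rw [conv_Ioc]
    calc ∫⁻ u, nu (Ioc (x - u) (x - u + 1)) ∂(convPow nu k)
        ≤ ∫⁻ u, (δ * convPow nu n (Ioi (x - u)) + (Ioc (x - A) x).indicator 1 u)
            ∂(convPow nu k) := lintegral_mono hpt
      _ = δ * ∫⁻ u, convPow nu n (Ioi (x - u)) ∂(convPow nu k)
            + convPow nu k (Ioc (x - A) x) := by
          rw [lintegral_add_right _ (measurable_one.indicator measurableSet_Ioc),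
            lintegral_indicator_one measurableSet_Ioc, lintegral_const_mul]
          have hanti : Antitone fun y => convPow nu n (Ioi y) :=
            fun a b hab => measure_mono (Ioi_subset_Ioi hab)
          exact hanti.measurable.comp (measurable_const.sub measurable_id)
      _ = δ * convPow nu (k + n) (Ioi x) + convPow nu k (Ioc (x - A) x) := by
          rw [convPow_add, conv_Ioi]
      _ ≤ δ * ((E + 1) * convPow nu n (Ioi x)) + ε / 2 * convPow nu n (Ioi x) := by
          gcongr
          exact hx2.trans (by gcongr; exact le_self_add)
      _ = ε * convPow nu n (Ioi x) := by
          rw [← mul_assoc, hδ, ENNReal.div_mul_cancel (by simp) (by simp [hE]), ← add_mul,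
            ENNReal.add_halves]

lemma negl_cpois {t : ℝ} (ht : 0 < t) {C : ENNReal} (hC : C ≠ ⊤)
    (hdom : ∀ᶠ x in atTop, cpois nu (2 * t) (Ioi x) ≤ C * H x)
    (h : ∀ k, Negl H (fun x => convPow nu k (Ioc x (x + 1)))) :
    Negl H (fun x => cpois nu t (Ioc x (x + 1))) := by
  intro ε hε
  have hε2 : ε / 2 ≠ 0 := (ENNReal.half_pos hε).ne'
  set K : ENNReal := ENNReal.ofReal (Real.exp t) * C with hK
  have hKt : K ≠ ⊤ := ENNReal.mul_ne_top ENNReal.ofReal_ne_top hC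
  obtain ⟨N, hN⟩ : ∃ N : ℕ, ENNReal.ofReal ((1/2) ^ N) * K ≤ ε / 2 := by
    have h1 : Tendsto (fun N : ℕ => ENNReal.ofReal ((1/2 : ℝ) ^ N) * K) atTop (nhds 0) := by
      have h2 : Tendsto (fun N : ℕ => ENNReal.ofReal ((1/2 : ℝ) ^ N)) atTop (nhds 0) := by
        have := ENNReal.tendsto_ofReal
          (tendsto_pow_atTop_nhds_zero_of_lt_one (r := (1/2 : ℝ)) (by norm_num) (by norm_num))
        simpa using this
      have := ENNReal.Tendsto.mul_const (b := K) h2 (Or.inr hKt)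
      simpa using this
    exact ((ENNReal.tendsto_nhds_zero.1 h1) _ (pos_iff_ne_zero.2 hε2)).exists
  have hfin := Negl.sum (H := H) (f := fun k x => pw t k * convPow nu k (Ioc x (x + 1)))
    (fun k => (h k).const_mul ENNReal.ofReal_ne_top) N
  filter_upwards [hfin _ hε2, hdom] with x hx1 hx2
  rw [cpois_apply _ _ measurableSet_Ioc]
  have hterm : ∀ k, pw t k * convPow nu k (Ioc x (x + 1)) ≤
      (if k ∈ Finset.range N then pw t k * convPow nu k (Ioc x (x + 1)) else 0) +
      ENNReal.ofReal (Real.exp t) * ENNReal.ofReal ((1/2) ^ N) *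
        (pw (2 * t) k * convPow nu k (Ioi x)) := by
    intro k
    split_ifs with hk
    · exact le_self_add
    · rw [zero_add, pw_two t ht k, mul_assoc _ (pw (2 * t) k)]
      have hk' : N ≤ k := by simpa using hk
      gcongr ?_ * ENNReal.ofReal ?_ * (_ * ?_)
      · exact le_rfl
      · exact pow_le_pow_of_le_one (by norm_num) (by norm_num) hk'
      · exact measure_mono Ioc_subset_Ioi_self
  calc _ ≤ ∑' k, ((if k ∈ Finset.range N then pw t k * convPow nu k (Ioc x (x + 1)) else 0) +
      ENNReal.ofReal (Real.exp t) * ENNReal.ofReal ((1/2) ^ N) *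
        (pw (2 * t) k * convPow nu k (Ioi x))) := ENNReal.tsum_le_tsum hterm
    _ = ∑ k ∈ Finset.range N, pw t k * convPow nu k (Ioc x (x + 1)) +
        ENNReal.ofReal (Real.exp t) * ENNReal.ofReal ((1/2) ^ N) * cpois nu (2 * t) (Ioi x) := by
      rw [ENNReal.tsum_add, ENNReal.tsum_mul_left, ← cpois_apply _ _ measurableSet_Ioi]
      congr 1
      rw [tsum_eq_sum (s := Finset.range N) (fun k hk => if_neg hk)]
      exact Finset.sum_congr rfl fun k hk => if_pos hk
    _ ≤ ε / 2 * H x + ENNReal.ofReal (Real.exp t) * ENNReal.ofReal ((1/2) ^ N) * (C * H x) := by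
      gcongr
    _ = ε / 2 * H x + ENNReal.ofReal ((1/2) ^ N) * K * H x := by rw [hK]; ring
    _ ≤ ε / 2 * H x + ε / 2 * H x := by gcongr
    _ = ε * H x := by rw [← add_mul, ENNReal.add_halves]

end setup

lemma long_tailed {g : ℝ → ℝ} (hpos : ∀ᶠ x in atTop, 0 < g x) (hg : Antitone g)
    (h1 : Tendsto (fun x => g (x + 1) / g x) atTop (nhds 1)) (a : ℝ) :
    Tendsto (fun x => g (x + a) / g x) atTop (nhds 1) := by
  have sh : ∀ b : ℝ, Tendsto (fun x : ℝ => x + b) atTop atTop := fun b =>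
    tendsto_atTop_add_const_right _ _ tendsto_id
  have hnat : ∀ n : ℕ, Tendsto (fun x => g (x + n) / g x) atTop (nhds 1) := by
    intro n
    induction n with
    | zero =>
      refine tendsto_const_nhds.congr' ?_
      filter_upwards [hpos] with x hx
      simp [hx.ne']
    | succ n ih =>
      have h2 := (h1.comp (sh n)).mul ih
      rw [one_mul] at h2
      refine h2.congr' ?_
      filter_upwards [(sh n).eventually hpos] with x hx
      simp only [Function.comp, Nat.cast_succ, ← add_assoc]
      field_simp
  have hnn : ∀ b : ℝ, 0 ≤ b → Tendsto (fun x => g (x + b) / g x) atTop (nhds 1) := by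
    intro b hb
    obtain ⟨n, hn⟩ := exists_nat_ge b
    refine tendsto_of_tendsto_of_tendsto_of_le_of_le' (hnat n) tendsto_const_nhds ?_ ?_
    · filter_upwards [hpos] with x hx
      exact div_le_div_of_nonneg_right (hg (by linarith)) hx.le
    · filter_upwards [hpos] with x hx
      exact (div_le_one hx).2 (hg (by linarith))
  rcases le_total 0 a with ha | ha
  · exact hnn a ha
  · have h2 := ((hnn (-a) (by linarith)).comp (sh a)).inv₀ one_ne_zero
    rw [inv_one] at h2
    refine h2.congr fun x => ?_
    simp [Function.comp]

lemma memL_iff_negl {ρ : Measure ℝ} (hfin : ∀ s, MeasurableSet s → ρ s ≠ ⊤)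
    (hpos : ∀ x : ℝ, 0 < x → 0 < ρ (Ioi x)) :
    MemL 0 ρ ↔ Negl (fun x => ρ (Ioi x)) (fun x => ρ (Ioc x (x + 1))) := by
  have h0 : ∀ᶠ x in atTop, ρ (Ioi x) ≠ 0 := by
    filter_upwards [eventually_gt_atTop 0] with x hx using (hpos x hx).ne'
  have htpos : ∀ᶠ x in atTop, 0 < tail ρ x := by
    filter_upwards [h0] with x hx
    exact ENNReal.toReal_pos hx (hfin _ measurableSet_Ioi)
  rw [negl_iff_tendsto h0 (fun x => hfin _ measurableSet_Ioi) (fun x => hfin _ measurableSet_Ioc)]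
  have heq : ∀ x, (ρ (Ioc x (x + 1))).toReal = tail ρ x - tail ρ (x + 1) := by
    intro x
    have hu : Ioc x (x + 1) ∪ Ioi (x + 1) = Ioi x := Ioc_union_Ioi_eq_Ioi (by linarith)
    have : ρ (Ioi x) = ρ (Ioc x (x + 1)) + ρ (Ioi (x + 1)) := by
      rw [← hu, measure_union _ measurableSet_Ioi]
      exact Ioc_disjoint_Ioi le_rfl
    unfold tail
    rw [this, ENNReal.toReal_add (hfin _ measurableSet_Ioc) (hfin _ measurableSet_Ioi)]
    ring
  have hfun : (fun x => (ρ (Ioc x (x + 1))).toReal / (ρ (Ioi x)).toReal) =ᶠ[atTop]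
      fun x => 1 - tail ρ (x + 1) / tail ρ x := by
    filter_upwards [htpos] with x hx
    rw [heq, ← tail, sub_div, div_self hx.ne']
  rw [tendsto_congr' hfun]
  constructor
  · intro h
    have := (h.2 1).const_sub 1
    simpa using this
  · intro h
    refine ⟨hpos, fun a => ?_⟩
    have h1 : Tendsto (fun x => tail ρ (x + 1) / tail ρ x) atTop (nhds 1) := by
      have := h.const_sub 1
      simpa using this
    have hanti : Antitone (tail ρ) := fun x y hxy =>
      ENNReal.toReal_mono (hfin _ measurableSet_Ioi) (measure_mono (Ioi_subset_Ioi hxy))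
    simpa using long_tailed htpos hanti h1 a

theorem stmt16 (nu1 : MeasureTheory.Measure ℝ) [MeasureTheory.IsProbabilityMeasure nu1]
    (hsupp : nu1 (Set.Ioi 1) = 1)
    (n₀ : ℕ) (hn₀pos : 0 < n₀) (hn₀OS : MemOS (convPow nu1 n₀))
    (hn₀min : ∀ m : ℕ, 0 < m → MemOS (convPow nu1 m) → n₀ ≤ m)
    (hasymp : ∀ t : ℝ, 0 < t → TailAsymp (cpois nu1 t) (convPow nu1 n₀)) :
    (Tset nu1 0 = Set.Ioi (0 : ℝ) ∨ Tset nu1 0 = ∅) ∧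
    (Tset nu1 0 = Set.Ioi (0 : ℝ) ↔
      Filter.Tendsto (fun x : ℝ => (nu1 (Set.Ioc x (x + 1))).toReal / tail (convPow nu1 n₀) x)
        Filter.atTop (nhds 0)) := by
  have hHpos : ∀ x : ℝ, 0 < x → 0 < convPow nu1 n₀ (Ioi x) := hn₀OS.1
  have hH0 : ∀ᶠ x in atTop, convPow nu1 n₀ (Ioi x) ≠ 0 := by
    filter_upwards [eventually_gt_atTop 0] with x hx using (hHpos x hx).ne'
  have hHt : ∀ x, convPow nu1 n₀ (Ioi x) ≠ ⊤ := fun x => measure_ne_top _ _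
  have hLiff : ∀ t : ℝ, 0 < t → (MemL 0 (cpois nu1 t) ↔
      Negl (fun x => convPow nu1 n₀ (Ioi x)) (fun x => nu1 (Ioc x (x + 1)))) := by
    intro t ht
    have hcpos : ∀ x : ℝ, 0 < x → 0 < cpois nu1 t (Ioi x) := fun x hx =>
      lt_of_lt_of_le (ENNReal.mul_pos (pw_ne_zero ht n₀) (hHpos x hx).ne')
        (le_cpois nu1 t n₀ measurableSet_Ioi)
    rw [memL_iff_negl (fun s hs => cpois_ne_top nu1 ht hs) hcpos]
    constructor
    · intro h
      obtain ⟨C, hC, hC2⟩ := asymp_upper (hasymp t ht) hH0 hHt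
      have h2 := (h.of_dom hC hC2).const_mul (c := (pw t 1)⁻¹)
        (ENNReal.inv_ne_top.2 (pw_ne_zero ht 1))
      refine h2.mono (Eventually.of_forall fun x => ?_)
      have h3 := le_cpois nu1 t 1 (s := Ioc x (x + 1)) measurableSet_Ioc
      have h4 : convPow nu1 1 = nu1 := by simp [convPow]
      rw [h4] at h3
      calc nu1 (Ioc x (x + 1)) = (pw t 1)⁻¹ * (pw t 1 * nu1 (Ioc x (x + 1))) := by
            rw [← mul_assoc, ENNReal.inv_mul_cancel (pw_ne_zero ht 1) ENNReal.ofReal_ne_top,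
              one_mul]
        _ ≤ _ := by gcongr
    · intro h
      obtain ⟨C1, hC1, hC12⟩ := asymp_upper (hasymp 1 one_pos) hH0 hHt
      obtain ⟨C2, hC2, hC22⟩ := asymp_upper (hasymp (2 * t) (by linarith)) hH0 hHt
      obtain ⟨C3, hC3, hC32⟩ := asymp_lower (hasymp t ht) hH0 hHt
      have hk := negl_convPow hsupp n₀
        (convPow_dom (H := fun x => convPow nu1 n₀ (Ioi x)) hC1 hC12) h
      exact (negl_cpois (H := fun x => convPow nu1 n₀ (Ioi x)) ht hC2 hC22 hk).of_dom hC3 hC32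
  have hT := negl_iff_tendsto (f := fun x => nu1 (Ioc x (x + 1))) hH0 hHt
    (fun x => measure_ne_top _ _)
  have hcond : ∀ t : ℝ, 0 < t → (MemL 0 (cpois nu1 t) ↔ Tendsto (fun x : ℝ =>
      (nu1 (Set.Ioc x (x + 1))).toReal / tail (convPow nu1 n₀) x) atTop (nhds 0)) :=
    fun t ht => (hLiff t ht).trans hT
  constructor
  · by_cases hP : Tendsto (fun x : ℝ =>
      (nu1 (Set.Ioc x (x + 1))).toReal / tail (convPow nu1 n₀) x) atTop (nhds 0)
    · left
      ext t
      exact ⟨fun h => h.1, fun h => ⟨h, (hcond t h).2 hP⟩⟩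
    · right
      ext t
      exact ⟨fun h => hP ((hcond t h.1).1 h.2), fun h => h.elim⟩
  · constructor
    · intro h
      have h1 : (1 : ℝ) ∈ Tset nu1 0 := by rw [h]; exact mem_Ioi.2 one_pos
      exact (hcond 1 one_pos).1 h1.2
    · intro hP
      ext t
      exact ⟨fun h => h.1, fun h => ⟨h, (hcond t h).2 hP⟩⟩
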